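/- Let i, k ≥ 2 and j, l ≥ 1 be integers, and let · denote the Euclidean dot product in ℝ². Then: (a) ∫_△ ṽ^I_{ij} · B_{kl} dx dy = 0 whenever (i,j) ≠ (k,l), and ∫_△ ṽ^I_{ij} · B_{ij} dx dy ≠ 0; (b) ∫_△ ṽ^I_{ij} · C_{kl} dx dy = 0 for all such indices; (c) ∫_△ ṽ^II_{ij} · B_{kl} dx dy = 0 for all such indices; (d) ∫_△ ṽ^II_{ij} · C_{kl} dx dy = 0 whenever (i,j) ≠ (k,l), and ∫_△ ṽ^II_{ij} · C_{ij} dx dy ≠ 0. That is, the auxiliary H(curl) fields ṽ^I, ṽ^II on the triangle and the dual candidates B, C are biorthogonal. -/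

import Mathlib

open MeasureTheory

/-- Jacobi polynomial `P_n^{(a,b)}` via the Rodrigues formula (on `(-1,1)`). -/
noncomputable def jacobiP (n a b : ℕ) (x : ℝ) : ℝ :=
  (1 / ((2:ℝ)^n * (Nat.factorial n : ℝ) * (1 - x)^a * (1 + x)^b)) *
    iteratedDeriv n (fun t : ℝ => (1 - t)^a * (1 + t)^b * (t^2 - 1)^n) x

/-- Legendre polynomial `L_n = P_n^{(0,0)}`. -/
noncomputable def legendreP (n : ℕ) (x : ℝ) : ℝ := jacobiP n 0 0 x

/-- Integrated Jacobi polynomial `P̂_n^a(x) = ∫_{-1}^x P_{n-1}^{(a,0)}(t) dt`. -/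
noncomputable def intJacobiP (n a : ℕ) (x : ℝ) : ℝ :=
  ∫ t in (-1:ℝ)..x, jacobiP (n - 1) a 0 t

/-- Integrated Legendre polynomial `L̂_n`. -/
noncomputable def intLegendreP (n : ℕ) (x : ℝ) : ℝ := intJacobiP n 0 x

/-- The open reference triangle with vertices `(-1,-1)`, `(1,-1)`, `(0,1)`. -/
def Tri : Set (ℝ × ℝ) := {p | -1 < p.2 ∧ p.2 < 1 ∧ |p.1| < (1 - p.2) / 2}

/-- Euclidean dot product in `ℝ²`. -/
def dot2 (p q : ℝ × ℝ) : ℝ := p.1 * q.1 + p.2 * q.2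

/-- Auxiliary `H(curl)` interior field `ṽ^I_{ij} = (∇f_i) g_{ij}` on the triangle. -/
noncomputable def vtTriI (i j : ℕ) (p : ℝ × ℝ) : ℝ × ℝ :=
  (legendreP (i-1) (2*p.1 / (1 - p.2)) * ((1 - p.2)/2)^(i-1) * intJacobiP j (2*i) p.2,
   (1/2) * legendreP (i-2) (2*p.1 / (1 - p.2)) * ((1 - p.2)/2)^(i-1) * intJacobiP j (2*i) p.2)

/-- Auxiliary `H(curl)` interior field `ṽ^II_{ij} = f_i ∇g_{ij}` on the triangle. -/
noncomputable def vtTriII (i j : ℕ) (p : ℝ × ℝ) : ℝ × ℝ :=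
  (0, intLegendreP i (2*p.1 / (1 - p.2)) * ((1 - p.2)/2)^i * jacobiP (j-1) (2*i) 0 p.2)

/-- First dual candidate `B_{kl}` on the triangle. -/
noncomputable def Btri (k l : ℕ) (p : ℝ × ℝ) : ℝ × ℝ :=
  (legendreP (k-1) (2*p.1 / (1 - p.2)) * ((1 - p.2)/2)^(k-1) * jacobiP (l-1) (2*k-1) 1 p.2, 0)

/-- Second dual candidate `C_{kl}` on the triangle. -/
noncomputable def Ctri (k l : ℕ) (p : ℝ × ℝ) : ℝ × ℝ :=
  (((k:ℝ) + 1) * jacobiP (k-1) 1 1 (2*p.1 / (1 - p.2)) * ((1 - p.2)/2)^(k-1) *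
     jacobiP (l-1) (2*k) 0 p.2,
   -2*(k:ℝ) * jacobiP (k-2) 1 1 (2*p.1 / (1 - p.2)) * ((1 - p.2)/2)^(k-1) *
     jacobiP (l-1) (2*k) 0 p.2)

open Polynomial

noncomputable def Ip : ℝ[X] →ₗ[ℝ] ℝ where
  toFun p := ∫ x in (-1:ℝ)..1, p.eval x
  map_add' p q := by
    simp only [eval_add]
    exact intervalIntegral.integral_add (p.continuous.intervalIntegrable _ _)
      (q.continuous.intervalIntegrable _ _)
  map_smul' c p := by
    simp only [eval_smul, smul_eq_mul, RingHom.id_apply]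
    exact intervalIntegral.integral_const_mul _ _

lemma Ip_apply (p : ℝ[X]) : Ip p = ∫ x in (-1:ℝ)..1, p.eval x := rfl

lemma Ip_C_mul (c : ℝ) (p : ℝ[X]) : Ip (C c * p) = c * Ip p := by
  rw [← smul_eq_C_mul, map_smul, smul_eq_mul]

lemma Ip_deriv (p : ℝ[X]) : Ip (derivative p) = p.eval 1 - p.eval (-1) := by
  rw [Ip_apply]
  exact intervalIntegral.integral_eq_sub_of_hasDerivAt (fun x _ => p.hasDerivAt x)
    ((derivative p).continuous.intervalIntegrable _ _)

lemma Ip_parts (p q : ℝ[X]) : Ip (derivative p * q) =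
    p.eval 1 * q.eval 1 - p.eval (-1) * q.eval (-1) - Ip (p * derivative q) := by
  have := Ip_deriv (p * q)
  rw [derivative_mul, map_add, eval_mul, eval_mul] at this
  linarith

lemma Ip_iter (n : ℕ) : ∀ (W q : ℝ[X]), (X^2 - 1)^n ∣ W →
    Ip (derivative^[n] W * q) = (-1)^n * Ip (W * derivative^[n] q) := by
  induction n with
  | zero => intro W q _; simp
  | succ n ih =>
    intro W q h
    have h1 : (X^2 - 1 : ℝ[X]) ∣ derivative^[n] W := by
      have := pow_sub_dvd_iterate_derivative_of_pow_dvd n h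
      simpa using this
    obtain ⟨r, hr⟩ := h1
    have e1 : (derivative^[n] W).eval 1 = 0 := by rw [hr]; simp
    have e2 : (derivative^[n] W).eval (-1) = 0 := by rw [hr]; simp
    rw [Function.iterate_succ_apply', Ip_parts, e1, e2, ih _ _ (dvd_trans (pow_dvd_pow _ (Nat.le_succ n)) h),
      Function.iterate_succ_apply]
    ring

noncomputable def Wt (n a b : ℕ) : ℝ[X] := (1 - X)^a * (1 + X)^b * (X^2-1)^n

lemma hC2 : (C (2:ℝ)) = 2 := map_ofNat C 2

lemma exJ (n a b : ℕ) : ∃ p : ℝ[X], derivative^[n] (Wt n a b) =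
    C ((2:ℝ)^n * (Nat.factorial n : ℝ)) * ((1 - X)^a * (1 + X)^b * p) := by
  have h1 : ((1 - X)^a : ℝ[X]) ∣ derivative^[n] (Wt n a b) := by
    have := pow_sub_dvd_iterate_derivative_of_pow_dvd (p := Wt n a b) (q := 1 - X) (n := a + n) n
      ⟨(1+X)^(b+n) * (-1)^n, by
        rw [Wt, show (X^2 - 1 : ℝ[X]) = (1 - X) * (1 + X) * (-1) by ring, mul_pow, mul_pow]; ring⟩
    simpa using this
  have h2 : ((1 + X)^b : ℝ[X]) ∣ derivative^[n] (Wt n a b) := by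
    have := pow_sub_dvd_iterate_derivative_of_pow_dvd (p := Wt n a b) (q := 1 + X) (n := b + n) n
      ⟨(1-X)^(a+n) * (-1)^n, by
        rw [Wt, show (X^2 - 1 : ℝ[X]) = (1 - X) * (1 + X) * (-1) by ring, mul_pow, mul_pow]; ring⟩
    simpa using this
  have hc : IsCoprime (1 - X : ℝ[X]) (1 + X) :=
    ⟨C (1/2), C (1/2), by
      rw [← mul_add, show (1 - X + (1 + X) : ℝ[X]) = C 2 by rw [hC2]; ring, ← C_mul]; norm_num⟩
  obtain ⟨p, hp⟩ := (hc.pow (m := a) (n := b)).mul_dvd h1 h2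
  have hne : ((2:ℝ)^n * (Nat.factorial n : ℝ)) ≠ 0 := by positivity
  refine ⟨C (((2:ℝ)^n * (Nat.factorial n : ℝ))⁻¹) * p, ?_⟩
  rw [hp]
  have : C ((2:ℝ)^n * (Nat.factorial n : ℝ)) * C (((2:ℝ)^n * (Nat.factorial n : ℝ))⁻¹) = 1 := by
    rw [← C_mul, mul_inv_cancel₀ hne, C_1]
  linear_combination (-(1-X)^a * (1+X)^b * p) * this

noncomputable def J (n a b : ℕ) : ℝ[X] := (exJ n a b).choose

lemma J_spec (n a b : ℕ) : derivative^[n] (Wt n a b) =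
    C ((2:ℝ)^n * (Nat.factorial n : ℝ)) * ((1 - X)^a * (1 + X)^b * J n a b) :=
  (exJ n a b).choose_spec

lemma iteratedDeriv_poly (n : ℕ) (p : ℝ[X]) :
    iteratedDeriv n (fun t => p.eval t) = fun t => (derivative^[n] p).eval t := by
  induction n with
  | zero => simp
  | succ n ih =>
    rw [iteratedDeriv_succ, ih, Function.iterate_succ_apply']
    funext t
    exact Polynomial.deriv _

lemma jacobiP_eq (n a b : ℕ) {x : ℝ} (h1 : -1 < x) (h2 : x < 1) :
    jacobiP n a b x = (J n a b).eval x := by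
  have : (fun t : ℝ => (1 - t)^a * (1 + t)^b * (t^2 - 1)^n) = fun t => (Wt n a b).eval t := by
    funext t; simp [Wt]
  rw [jacobiP, this, iteratedDeriv_poly, J_spec]
  have e1 : (1 - x) ≠ 0 := by linarith
  have e2 : (1 + x) ≠ 0 := by linarith
  simp
  field_simp

lemma Ip_J (n a b : ℕ) (q : ℝ[X]) :
    ((2:ℝ)^n * (Nat.factorial n : ℝ)) * Ip ((1 - X)^a * (1 + X)^b * J n a b * q) =
      (-1)^n * Ip (Wt n a b * derivative^[n] q) := by
  rw [← Ip_iter n (Wt n a b) q (Dvd.intro_left _ rfl), J_spec, ← Ip_C_mul]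
  congr 1; ring

lemma J_orth (n a b : ℕ) (q : ℝ[X]) (h : q.natDegree < n) :
    Ip ((1 - X)^a * (1 + X)^b * J n a b * q) = 0 := by
  have := Ip_J n a b q
  rw [iterate_derivative_eq_zero h, mul_zero, map_zero, mul_zero] at this
  exact (mul_eq_zero.1 this).resolve_left (by positivity)

lemma Ip_Wt (n a b : ℕ) : Ip (Wt n a b) ≠ 0 := by
  have : Wt n a b = C ((-1)^n) * ((1 - X)^(a+n) * (1 + X)^(b+n)) := by
    rw [Wt, show (X^2 - 1 : ℝ[X]) = (1 - X) * (1 + X) * (-1) by ring, mul_pow, mul_pow]; simp; ring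
  rw [this, Ip_C_mul]
  refine mul_ne_zero (by simp) (ne_of_gt ?_)
  rw [Ip_apply]
  refine intervalIntegral.intervalIntegral_pos_of_pos_on (Polynomial.continuous _ |>.intervalIntegrable _ _) ?_ (by norm_num)
  intro x hx
  have e1 : 0 < (1 - x) := by linarith [hx.2]
  have e2 : 0 < (1 + x) := by linarith [hx.1]
  simp
  positivity

lemma iter_top (q : ℝ[X]) : derivative^[q.natDegree] q =
    C ((q.natDegree.factorial : ℝ) * q.leadingCoeff) := by
  have h : (derivative^[q.natDegree] q).natDegree = 0 := by
    have := natDegree_iterate_derivative q q.natDegree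
    omega
  rw [eq_C_of_natDegree_eq_zero h, coeff_iterate_derivative]
  simp [Nat.descFactorial_self]

lemma J_nonorth (n a b : ℕ) (q : ℝ[X]) (h : q.natDegree = n) (hq : q ≠ 0) :
    Ip ((1 - X)^a * (1 + X)^b * J n a b * q) ≠ 0 := by
  intro h0
  have h5 := Ip_J n a b q
  subst h
  rw [h0, mul_zero, iter_top, mul_comm (Wt _ _ _), Ip_C_mul] at h5
  have h1 : q.leadingCoeff ≠ 0 := leadingCoeff_ne_zero.2 hq
  have h2 := Ip_Wt q.natDegree a b
  have h3 : (q.natDegree.factorial : ℝ) ≠ 0 := by positivity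
  have : (-1:ℝ)^q.natDegree * ((q.natDegree.factorial : ℝ) * q.leadingCoeff * Ip (Wt q.natDegree a b)) ≠ 0 :=
    mul_ne_zero (by simp) (mul_ne_zero (mul_ne_zero h3 h1) h2)
  exact this h5.symm

lemma J_ne (n a b : ℕ) : J n a b ≠ 0 := by
  intro h
  apply J_nonorth n a b (X^n) (by simp) (by simp)
  rw [h]; simp

lemma deg_iter (n : ℕ) (p : ℝ[X]) : (derivative^[n] p).natDegree = p.natDegree - n := by
  induction n with
  | zero => simp
  | succ n ih => rw [Function.iterate_succ_apply', natDegree_derivative, ih]; omega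

lemma nd1 : (1 - X : ℝ[X]).natDegree = 1 := by
  rw [← natDegree_neg]; simpa using natDegree_X_sub_C (1:ℝ)
lemma nd2 : (1 + X : ℝ[X]).natDegree = 1 := by
  rw [add_comm]; simpa using natDegree_X_add_C (1:ℝ)
lemma nz1 : (1 - X : ℝ[X]) ≠ 0 := fun h => by have := nd1; rw [h] at this; simp at this
lemma nz2 : (1 + X : ℝ[X]) ≠ 0 := fun h => by have := nd2; rw [h] at this; simp at this

lemma J_deg (n a b : ℕ) : (J n a b).natDegree = n := by
  have h := congrArg natDegree (J_spec n a b)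
  have e : (X^2 - 1 : ℝ[X]) = C (-1) * ((1 - X) * (1 + X)) := by simp; ring
  have n3 : (X^2 - 1 : ℝ[X]).natDegree = 2 := by
    rw [e, natDegree_C_mul (by norm_num), natDegree_mul nz1 nz2, nd1, nd2]
  have z3 : (X^2 - 1 : ℝ[X]) ≠ 0 := fun h => by rw [h] at n3; simp at n3
  have za : ((1 - X)^a : ℝ[X]) ≠ 0 := pow_ne_zero _ nz1
  have zb : ((1 + X)^b : ℝ[X]) ≠ 0 := pow_ne_zero _ nz2
  rw [deg_iter, Wt, natDegree_mul (mul_ne_zero za zb) (pow_ne_zero _ z3), natDegree_C_mul (by positivity),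
    natDegree_mul (mul_ne_zero za zb) (J_ne n a b), natDegree_mul za zb, natDegree_pow, natDegree_pow,
    natDegree_pow, nd1, nd2, n3] at h
  omega

lemma exAnti (p : ℝ[X]) (c : ℝ) : ∃ q : ℝ[X], derivative q = p ∧ q.eval c = 0 := by
  have : ∃ q : ℝ[X], derivative q = p := by
    induction p using Polynomial.induction_on' with
    | add p q hp hq =>
      obtain ⟨a, ha⟩ := hp; obtain ⟨b, hb⟩ := hq
      exact ⟨a + b, by simp [ha, hb]⟩
    | monomial n a =>
      refine ⟨monomial (n+1) (a / (n+1)), ?_⟩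
      rw [derivative_monomial]
      have : ((n:ℝ)+1) ≠ 0 := by positivity
      simp; field_simp
  obtain ⟨q, hq⟩ := this
  exact ⟨q - C (q.eval c), by simp [hq], by simp⟩

noncomputable def K (n a : ℕ) : ℝ[X] := (exAnti (J (n-1) a 0) (-1)).choose
lemma K_der (n a : ℕ) : derivative (K n a) = J (n-1) a 0 := (exAnti (J (n-1) a 0) (-1)).choose_spec.1
lemma K_ev (n a : ℕ) : (K n a).eval (-1) = 0 := (exAnti (J (n-1) a 0) (-1)).choose_spec.2

lemma intJacobiP_eq (n a : ℕ) {x : ℝ} (h1 : -1 < x) (h2 : x < 1) :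
    intJacobiP n a x = (K n a).eval x := by
  have : intJacobiP n a x = ∫ t in (-1:ℝ)..x, (J (n-1) a 0).eval t := by
    apply intervalIntegral.integral_congr_ae
    refine Filter.Eventually.of_forall fun t ht => ?_
    rw [Set.uIoc_of_le h1.le] at ht
    exact jacobiP_eq _ _ _ ht.1 (by linarith [ht.2])
  rw [this, ← K_der, intervalIntegral.integral_eq_sub_of_hasDerivAt (fun x _ => (K n a).hasDerivAt x)
    ((derivative _).continuous.intervalIntegrable _ _), K_ev, sub_zero]

lemma K_fac (n a : ℕ) (hn : 1 ≤ n) : ∃ r : ℝ[X], K n a = (1 + X) * r ∧ r.natDegree = n - 1 ∧ r ≠ 0 := by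
  have : (X - C (-1 : ℝ)) ∣ K n a := dvd_iff_isRoot.2 (K_ev n a)
  obtain ⟨r, hr⟩ := this
  have e : (X - C (-1 : ℝ)) = 1 + X := by simp; ring
  rw [e] at hr
  have hr0 : r ≠ 0 := by
    rintro rfl
    have := K_der n a
    rw [hr] at this; simp at this
    exact J_ne _ _ _ this.symm
  refine ⟨r, hr, ?_, hr0⟩
  have h := congrArg natDegree (K_der n a)
  rw [natDegree_derivative, J_deg, hr, natDegree_mul nz2 hr0, nd2] at h
  omega

lemma exQ (a : ℕ) (q : ℝ[X]) (hq : q ≠ 0) : ∃ r : ℝ[X], derivative ((1 - X)^(a+1) * r) = (1 - X)^a * q ∧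
    r.natDegree = q.natDegree := by
  obtain ⟨Q, h1, h2⟩ := exAnti ((1 - X)^a * q) 1
  have hm := derivative_rootMultiplicity_of_root (p := Q) (t := 1) h2
  have hQ : Q ≠ 0 := by
    rintro rfl
    simp at h1
    rcases h1 with h | h
    · exact nz1 h.1
    · exact hq h
  have hd : derivative Q ≠ 0 := by rw [h1]; exact mul_ne_zero (pow_ne_zero _ nz1) hq
  have e : (1 - X : ℝ[X]) = -(X - C 1) := by simp
  have h3 : a ≤ (derivative Q).rootMultiplicity 1 := by
    rw [le_rootMultiplicity_iff hd, h1, e, neg_pow]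
    exact ⟨(-1)^a * q, by ring⟩
  have h4 : 0 < Q.rootMultiplicity 1 := (rootMultiplicity_pos hQ).2 h2
  have h5 : (X - C 1)^(a+1) ∣ Q := (le_rootMultiplicity_iff hQ).1 (by omega)
  obtain ⟨r, hr⟩ := h5
  have h6 : Q = (1 - X)^(a+1) * ((-1)^(a+1) * r) := by
    rw [e, neg_pow, hr, show ((-1)^(a+1) * (X - C 1)^(a+1) * ((-1)^(a+1) * r) : ℝ[X]) =
      ((-1)*(-1))^(a+1) * ((X - C 1)^(a+1) * r) by rw [mul_pow]; ring]
    simp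
  refine ⟨(-1)^(a+1) * r, by rw [← h6, h1], ?_⟩
  have hr0 : (-1)^(a+1) * r ≠ 0 := by intro h; rw [h, mul_zero] at h6; exact hQ h6
  have h := congrArg natDegree h1
  rw [natDegree_derivative, h6, natDegree_mul (pow_ne_zero _ nz1) hr0,
    natDegree_mul (pow_ne_zero _ nz1) hq, natDegree_pow, natDegree_pow, nd1] at h
  omega

lemma K_orth (n a : ℕ) (q : ℝ[X]) (h : q.natDegree < n - 1) :
    Ip ((1 - X)^a * q * K n (a+1)) = 0 := by
  by_cases hq : q = 0
  · simp [hq]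
  obtain ⟨r, h1, h2⟩ := exQ a q hq
  rw [← h1, Ip_parts, K_ev, K_der]
  have := J_orth (n-1) (a+1) 0 r (by omega)
  rw [pow_zero, mul_one] at this
  rw [show (1 - X)^(a+1) * r * J (n-1) (a+1) 0 = (1 - X)^(a+1) * J (n-1) (a+1) 0 * r by ring, this]
  simp

/-- Legendre -/
lemma L_spec (n : ℕ) : derivative^[n] ((X^2-1)^n) = C ((2:ℝ)^n * (Nat.factorial n : ℝ)) * J n 0 0 := by
  simpa [Wt] using J_spec n 0 0

lemma iter_leib (m : ℕ) (u : ℝ[X]) : derivative^[m+1] ((X^2-1) * derivative u) =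
    (X^2-1) * derivative^[m+2] u + 2*((m:ℝ[X])+1) * X * derivative^[m+1] u + ((m:ℝ[X])+1) * (m:ℝ[X]) * derivative^[m] u := by
  induction m with
  | zero => simp; ring
  | succ m ih =>
    rw [Function.iterate_succ_apply', ih]
    simp only [derivative_add, derivative_mul, ← Function.iterate_succ_apply' derivative]
    simp
    ring

lemma iter_leib2 (m : ℕ) (u : ℝ[X]) : derivative^[m+1] (X * u) =
    X * derivative^[m+1] u + ((m:ℝ[X])+1) * derivative^[m] u := by
  induction m with
  | zero => simp; ring
  | succ m ih =>
    rw [Function.iterate_succ_apply', ih]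
    simp only [derivative_add, derivative_mul, ← Function.iterate_succ_apply' derivative]
    simp
    ring

lemma leg_ode (m : ℕ) : (X^2-1) * derivative^[m+2] ((X^2-1)^(m+1) : ℝ[X]) =
    ((m:ℝ[X])+1)*((m:ℝ[X])+2) * derivative^[m] ((X^2-1)^(m+1) : ℝ[X]) := by
  set u : ℝ[X] := (X^2-1)^(m+1) with hu
  have h : (X^2-1) * derivative u = C (2*((m:ℝ)+1)) * (X * u) := by
    rw [hu, derivative_pow]; simp [hC2]; ring
  have h2 := congrArg (derivative^[m+1]) h
  rw [iter_leib, iterate_derivative_C_mul, iter_leib2] at h2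
  simp [hC2] at h2
  simp only [Function.iterate_succ_apply]
  linear_combination h2

lemma J11 (m : ℕ) : C ((m:ℝ)+2) * J m 1 1 = C 2 * derivative (J (m+1) 0 0) := by
  have h1 := J_spec m 1 1
  have e : Wt m 1 1 = C (-1) * (X^2-1)^(m+1) := by simp [Wt]; ring
  rw [e, iterate_derivative_C_mul] at h1
  have h2 := leg_ode m
  have h3 := congrArg derivative (L_spec (m+1))
  rw [← Function.iterate_succ_apply' derivative, derivative_C_mul] at h3
  rw [h3] at h2
  have z3 : (X^2 - 1 : ℝ[X]) ≠ 0 := by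
    rw [show (X^2 - 1 : ℝ[X]) = -((1 - X) * (1 + X)) by ring]
    exact neg_ne_zero.2 (mul_ne_zero nz1 nz2)
  have hc : (C ((2:ℝ)^m * ((m+1).factorial : ℝ))) ≠ 0 := by
    rw [Ne, C_eq_zero]; positivity
  apply mul_left_cancel₀ (mul_ne_zero z3 hc)
  rw [Nat.factorial_succ] at h2
  rw [Nat.factorial_succ]
  simp [hC2] at h1 h2
  simp only [C_mul, C_add, C_pow, hC2, map_natCast, Nat.cast_mul, Nat.cast_add, Nat.cast_one, C_1]
  linear_combination -h2 + ((m:ℝ[X])+1)*((m:ℝ[X])+2) * h1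

lemma L_one (n : ℕ) : (J n 0 0).eval 1 = 1 := by
  have h := aeval_iterate_derivative_self (R := ℝ) (A := ℝ) ((X^2-1)^n) n 1 (p' := (X+1)^n)
    (by simp; rw [← mul_pow]; ring)
  rw [L_spec] at h
  simp at h
  have h2 : ((2:ℝ)^n * (n.factorial : ℝ)) ≠ 0 := by positivity
  apply mul_left_cancel₀ h2
  rw [h]; norm_num; ring

lemma L_neg_one (n : ℕ) : (J n 0 0).eval (-1) = (-1)^n := by
  have h := aeval_iterate_derivative_self (R := ℝ) (A := ℝ) ((X^2-1)^n) n (-1) (p' := (X-1)^n)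
    (by simp; rw [← mul_pow]; ring)
  rw [L_spec] at h
  simp at h
  have h2 : ((2:ℝ)^n * (n.factorial : ℝ)) ≠ 0 := by positivity
  apply mul_left_cancel₀ h2
  rw [h, show (-1 - 1 : ℝ) = (-1) * 2 by norm_num, mul_pow]; ring

lemma L_orth (n : ℕ) (q : ℝ[X]) (h : q.natDegree < n) : Ip (J n 0 0 * q) = 0 := by
  simpa using J_orth n 0 0 q h

lemma L_orth' (m n : ℕ) (h : m ≠ n) : Ip (J m 0 0 * J n 0 0) = 0 := by
  rcases lt_or_gt_of_ne h with h | h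
  · rw [mul_comm]; exact L_orth _ _ (by rwa [J_deg])
  · exact L_orth _ _ (by rwa [J_deg])

lemma L_self (n : ℕ) : Ip (J n 0 0 * J n 0 0) ≠ 0 := by
  simpa using J_nonorth n 0 0 (J n 0 0) (J_deg _ _ _) (J_ne _ _ _)

lemma L_shift (m n : ℕ) : Ip (J (m+1) 0 0 * derivative (J (n+2) 0 0)) =
    Ip (J m 0 0 * derivative (J (n+1) 0 0)) := by
  rcases le_or_gt (n+1) m with h | h
  · rw [L_orth, L_orth]
    · rw [natDegree_derivative, J_deg]; omega
    · rw [natDegree_derivative, J_deg]; omega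
  · rw [mul_comm, Ip_parts, mul_comm (J m 0 0), Ip_parts, L_orth, L_orth]
    · simp only [L_one, L_neg_one]; ring
    · rw [natDegree_derivative, J_deg]; omega
    · rw [natDegree_derivative, J_deg]; omega

lemma Tri_meas : MeasurableSet Tri := by
  have h1 : IsOpen {p : ℝ × ℝ | -1 < p.2} := isOpen_lt (by fun_prop) (by fun_prop)
  have h2 : IsOpen {p : ℝ × ℝ | p.2 < 1} := isOpen_lt (by fun_prop) (by fun_prop)
  have h3 : IsOpen {p : ℝ × ℝ | |p.1| < (1 - p.2)/2} := isOpen_lt (by fun_prop) (by fun_prop)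
  exact (h1.inter (h2.inter h3)).measurableSet

lemma Tri_int (F G : ℝ[X]) : ∫ p in Tri, F.eval (2*p.1/(1-p.2)) * G.eval p.2 =
    Ip F * Ip (G * (C (1/2) * (1 - X))) := by
  have hm : MeasurableSet Tri := by
    exact Tri_meas
  have hη : ∀ p ∈ Tri, 2*p.1/(1-p.2) ∈ Set.Icc (-1:ℝ) 1 := by
    rintro p ⟨h1, h2, h3⟩
    have : 0 < 1 - p.2 := by linarith
    rw [abs_lt] at h3
    exact ⟨by rw [le_div_iff₀ this]; linarith, by rw [div_le_iff₀ this]; linarith⟩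
  have hfin : volume Tri ≠ ⊤ := by
    have : Tri ⊆ Set.Icc (-1:ℝ) 1 ×ˢ Set.Icc (-1:ℝ) 1 := by
      rintro p ⟨h1, h2, h3⟩
      rw [abs_lt] at h3
      exact ⟨⟨by linarith, by linarith⟩, ⟨by linarith, by linarith⟩⟩
    exact ((isCompact_Icc.prod isCompact_Icc).measure_lt_top.trans_le' (measure_mono this)).ne
  obtain ⟨A, hA⟩ := (isCompact_Icc (a := (-1:ℝ)) (b := 1)).exists_bound_of_continuousOn F.continuous.continuousOn
  obtain ⟨B, hB⟩ := (isCompact_Icc (a := (-1:ℝ)) (b := 1)).exists_bound_of_continuousOn G.continuous.continuousOn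
  have hFm : Measurable (fun p : ℝ × ℝ => F.eval (2*p.1/(1-p.2))) :=
    F.continuous.measurable.comp (by fun_prop)
  have hGm : Measurable (fun p : ℝ × ℝ => G.eval p.2) := G.continuous.measurable.comp (by fun_prop)
  have hint : IntegrableOn (fun p : ℝ × ℝ => F.eval (2*p.1/(1-p.2)) * G.eval p.2) Tri := by
    refine Measure.integrableOn_of_bounded (M := A * B) hfin (hFm.mul hGm).aestronglyMeasurable ?_
    refine (ae_restrict_iff' hm).2 (Filter.Eventually.of_forall fun p hp => ?_)
    rw [norm_mul]
    have a1 := hA _ (hη p hp)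
    have b1 := hB p.2 ⟨hp.1.le, hp.2.1.le⟩
    exact mul_le_mul a1 b1 (norm_nonneg _) ((norm_nonneg _).trans a1)
  rw [← integral_indicator hm, Measure.volume_eq_prod, integral_prod_symm _ (by
    rw [← Measure.volume_eq_prod]; exact (integrable_indicator_iff hm).2 hint)]
  have inner : ∀ y : ℝ, (∫ x : ℝ, Tri.indicator (fun p : ℝ × ℝ => F.eval (2*p.1/(1-p.2)) * G.eval p.2) (x, y)) =
      (Set.Ioo (-1:ℝ) 1).indicator (fun y => Ip F * (G * (C (1/2) * (1 - X))).eval y) y := by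
    intro y
    by_cases hy : y ∈ Set.Ioo (-1:ℝ) 1
    · rw [Set.indicator_of_mem hy]
      have hy2 : 0 < (1 - y)/2 := by linarith [hy.2]
      have : (fun x : ℝ => Tri.indicator (fun p : ℝ × ℝ => F.eval (2*p.1/(1-p.2)) * G.eval p.2) (x, y)) =
        (Set.Ioo (-((1-y)/2)) ((1-y)/2)).indicator (fun x => F.eval (x / ((1-y)/2)) * G.eval y) := by
        funext x
        by_cases hx : x ∈ Set.Ioo (-((1-y)/2)) ((1-y)/2)
        · rw [Set.indicator_of_mem hx, Set.indicator_of_mem (show (x,y) ∈ Tri from ⟨hy.1, hy.2, abs_lt.2 hx⟩)]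
          simp only
          congr 2
          have : 1 - y ≠ 0 := by linarith
          field_simp
        · rw [Set.indicator_of_notMem hx, Set.indicator_of_notMem]
          exact fun h => hx (abs_lt.1 h.2.2)
      rw [this, integral_indicator measurableSet_Ioo, ← integral_Ioc_eq_integral_Ioo,
        ← intervalIntegral.integral_of_le (by linarith), intervalIntegral.integral_mul_const,
        intervalIntegral.integral_comp_div (fun x => F.eval x) hy2.ne', neg_div, div_self hy2.ne',
        ← Ip_apply]
      simp
      ring
    · rw [Set.indicator_of_notMem hy]
      have : (fun x : ℝ => Tri.indicator (fun p : ℝ × ℝ => F.eval (2*p.1/(1-p.2)) * G.eval p.2) (x, y)) = 0 := by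
        funext x
        rw [Set.indicator_of_notMem]; rfl
        exact fun h => hy ⟨h.1, h.2.1⟩
      rw [this]; simp
  simp_rw [inner]
  rw [integral_indicator measurableSet_Ioo, ← integral_Ioc_eq_integral_Ioo,
        ← intervalIntegral.integral_of_le (by norm_num), intervalIntegral.integral_const_mul, ← Ip_apply]

lemma Tri_int' (f : ℝ × ℝ → ℝ) (F G : ℝ[X])
    (h : ∀ η y : ℝ, -1 < η → η < 1 → -1 < y → y < 1 → ∀ p : ℝ × ℝ, p.2 = y → 2*p.1/(1-p.2) = η →
      f p = F.eval η * G.eval y) : ∫ p in Tri, f p = Ip F * Ip (G * (C (1/2) * (1 - X))) := by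
  rw [← Tri_int]
  apply setIntegral_congr_fun
  · exact Tri_meas
  · rintro p ⟨h1, h2, h3⟩
    have : 0 < 1 - p.2 := by linarith
    rw [abs_lt] at h3
    exact h _ _ (by rw [lt_div_iff₀ this]; linarith) (by rw [div_lt_iff₀ this]; linarith) h1 h2 p rfl rfl

noncomputable def Hf : ℝ[X] := C (1/2) * (1 - X)

lemma Hf_pow (m : ℕ) : Hf^m = C ((1/2)^m) * (1 - X)^m := by
  rw [Hf, mul_pow, C_pow]

lemma Hf_eval (y : ℝ) : Hf.eval y = (1 - y)/2 := by
  simp [Hf]; ring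

lemma partA (m l j : ℕ) (hj : 1 ≤ j) (h : l ≠ j - 1) :
    Ip ((1 - X)^m * J l m 1 * K j (m+1)) = 0 := by
  rcases lt_or_gt_of_ne h with h | h
  · exact K_orth j m _ (by rwa [J_deg])
  · obtain ⟨r, h1, h2, h3⟩ := K_fac j (m+1) hj
    have := J_orth l m 1 r (by omega)
    rw [← this, h1]; congr 1; ring

lemma partA' (m j : ℕ) (hj : 1 ≤ j) :
    Ip ((1 - X)^m * J (j-1) m 1 * K j (m+1)) ≠ 0 := by
  obtain ⟨r, h1, h2, h3⟩ := K_fac j (m+1) hj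
  have := J_nonorth (j-1) m 1 r h2 h3
  convert this using 2
  rw [h1]; ring

lemma partD (m l j : ℕ) (h : l ≠ j) : Ip ((1 - X)^m * J l m 0 * J j m 0) = 0 := by
  rcases lt_or_gt_of_ne h with h | h
  · have := J_orth j m 0 (J l m 0) (by rwa [J_deg])
    rw [← this]; congr 1; ring
  · have := J_orth l m 0 (J j m 0) (by rwa [J_deg])
    rw [← this]; congr 1; ring

lemma partD' (m l : ℕ) : Ip ((1 - X)^m * J l m 0 * J l m 0) ≠ 0 := by
  have := J_nonorth l m 0 (J l m 0) (J_deg _ _ _) (J_ne _ _ _)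
  convert this using 2
  ring

lemma IB (i j k l : ℕ) : ∫ p in Tri, dot2 (vtTriI i j p) (Btri k l p) =
    Ip (J (i-1) 0 0 * J (k-1) 0 0) *
      Ip (Hf^(i-1) * Hf^(k-1) * K j (2*i) * J (l-1) (2*k-1) 1 * Hf) := by
  apply Tri_int'
  rintro η y h1 h2 h3 h4 p rfl rfl
  simp only [dot2, vtTriI, Btri, legendreP, jacobiP_eq _ _ _ h1 h2, jacobiP_eq _ _ _ h3 h4,
    intJacobiP_eq _ _ h3 h4, eval_mul, eval_pow, Hf_eval]
  ring

lemma IC (i j k l : ℕ) : ∫ p in Tri, dot2 (vtTriI i j p) (Ctri k l p) =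
    Ip (J (i-1) 0 0 * (C ((k:ℝ)+1) * J (k-1) 1 1) - J (i-2) 0 0 * (C (k:ℝ) * J (k-2) 1 1)) *
      Ip (Hf^(i-1) * Hf^(k-1) * K j (2*i) * J (l-1) (2*k) 0 * Hf) := by
  apply Tri_int'
  rintro η y h1 h2 h3 h4 p rfl rfl
  simp only [dot2, vtTriI, Ctri, legendreP, jacobiP_eq _ _ _ h1 h2, jacobiP_eq _ _ _ h3 h4,
    intJacobiP_eq _ _ h3 h4, eval_mul, eval_pow, Hf_eval, eval_sub, eval_C]
  ring

lemma IIC (i j k l : ℕ) : ∫ p in Tri, dot2 (vtTriII i j p) (Ctri k l p) =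
    Ip (K i 0 * (C (k:ℝ) * J (k-2) 1 1)) *
      Ip (C (-2) * (Hf^i * Hf^(k-1) * J (j-1) (2*i) 0 * J (l-1) (2*k) 0) * Hf) := by
  apply Tri_int'
  rintro η y h1 h2 h3 h4 p rfl rfl
  simp only [dot2, vtTriII, Ctri, intLegendreP, jacobiP_eq _ _ _ h1 h2, jacobiP_eq _ _ _ h3 h4,
    intJacobiP_eq _ _ h1 h2, eval_mul, eval_pow, Hf_eval, eval_C]
  ring

lemma IBy (i j l : ℕ) (hi : 2 ≤ i) :
    Ip (Hf^(i-1) * Hf^(i-1) * K j (2*i) * J (l-1) (2*i-1) 1 * Hf) =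
     (1/2)^(2*i-1) * Ip ((1 - X)^(2*i-1) * J (l-1) (2*i-1) 1 * K j (2*i-1+1)) := by
  obtain ⟨m, rfl⟩ := Nat.exists_eq_add_of_le' hi
  rw [← Ip_C_mul]
  have e : 2 * (m+2) - 1 + 1 = 2 * (m+2) := by omega
  have e2 : (m+2-1) + (m+2-1) + 1 = 2 * (m+2) - 1 := by omega
  have := Hf_pow (2*(m+2)-1)
  rw [e]
  congr 1
  have h2 : Hf^(m+2-1) * Hf^(m+2-1) * Hf = Hf^(2*(m+2)-1) := by rw [← e2]; ring
  rw [this] at h2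
  linear_combination (K j (2*(m+2)) * J (l-1) (2*(m+2)-1) 1) * h2

lemma ICy (i j l : ℕ) (hi : 2 ≤ i) :
    Ip (C (-2) * (Hf^i * Hf^(i-1) * J (j-1) (2*i) 0 * J (l-1) (2*i) 0) * Hf) =
     (-2 * (1/2)^(2*i)) * Ip ((1 - X)^(2*i) * J (j-1) (2*i) 0 * J (l-1) (2*i) 0) := by
  rw [← Ip_C_mul]
  have h2 : Hf^i * Hf^(i-1) * Hf = Hf^(2*i) := by
    rw [mul_assoc, ← pow_succ, ← pow_add]; congr 1; omega
  rw [Hf_pow (2*i)] at h2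
  congr 1
  rw [C_mul]
  linear_combination (C (-2) * J (j-1) (2*i) 0 * J (l-1) (2*i) 0) * h2

lemma Cx (i k : ℕ) (hi : 2 ≤ i) (hk : 2 ≤ k) :
    Ip (K i 0 * (C (k:ℝ) * J (k-2) 1 1)) = -2 * Ip (J (i-1) 0 0 * J (k-1) 0 0) := by
  obtain ⟨m, rfl⟩ := Nat.exists_eq_add_of_le' hk
  have h := J11 m
  have e : (((m+2:ℕ)):ℝ) = (m:ℝ)+2 := by push_cast; ring
  rw [e, show m + 2 - 2 = m from rfl, h, show K i 0 * (C 2 * derivative (J (m+1) 0 0)) =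
    C 2 * (derivative (J (m+1) 0 0) * K i 0) by ring, Ip_C_mul, Ip_parts, K_ev, K_der]
  have h1 : (K i 0).eval 1 = 0 := by
    have a := Ip_deriv (K i 0)
    rw [K_ev, K_der, sub_zero] at a
    rw [← a]
    simpa using L_orth (i-1) 1 (by simp; omega)
  rw [h1, show m + 2 - 1 = m + 1 from rfl, mul_comm (J (i-1) 0 0)]
  ring

lemma ICx (i k : ℕ) (hi : 2 ≤ i) (hk : 2 ≤ k) :
    Ip (J (i-1) 0 0 * (C ((k:ℝ)+1) * J (k-1) 1 1) - J (i-2) 0 0 * (C (k:ℝ) * J (k-2) 1 1)) = 0 := by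
  obtain ⟨m, rfl⟩ := Nat.exists_eq_add_of_le' hk
  obtain ⟨n, rfl⟩ := Nat.exists_eq_add_of_le' hi
  have h := J11 m
  have h' := J11 (m+1)
  have e : (((m+2:ℕ)):ℝ) = (m:ℝ)+2 := by push_cast; ring
  have e' : ((m:ℝ)+2+1) = ((m+1:ℕ):ℝ)+2 := by push_cast; ring
  rw [e, e', show m + 2 - 2 = m from rfl, show m + 2 - 1 = m + 1 from rfl, h, h',
    show n + 2 - 2 = n from rfl, show n + 2 - 1 = n + 1 from rfl,
    mul_left_comm, mul_left_comm (J n 0 0), map_sub, Ip_C_mul, Ip_C_mul, L_shift, sub_self]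

/-- Biorthogonality of the auxiliary `H(curl)` fields on the triangle and the
dual candidates `B`, `C`. -/
theorem triangle_Hcurl_aux_biorthogonal (i j k l : ℕ) (hi : 2 ≤ i) (hk : 2 ≤ k)
    (hj : 1 ≤ j) (hl : 1 ≤ l) :
    ((i, j) ≠ (k, l) → ∫ p in Tri, dot2 (vtTriI i j p) (Btri k l p) = 0) ∧
    (∫ p in Tri, dot2 (vtTriI i j p) (Btri i j p)) ≠ 0 ∧
    (∫ p in Tri, dot2 (vtTriI i j p) (Ctri k l p) = 0) ∧
    (∫ p in Tri, dot2 (vtTriII i j p) (Btri k l p) = 0) ∧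
    ((i, j) ≠ (k, l) → ∫ p in Tri, dot2 (vtTriII i j p) (Ctri k l p) = 0) ∧
    (∫ p in Tri, dot2 (vtTriII i j p) (Ctri i j p)) ≠ 0 := by
  refine ⟨fun h => ?_, ?_, ?_, ?_, fun h => ?_, ?_⟩
  · rw [IB]
    by_cases hik : i = k
    · subst hik
      rw [IBy i j l hi, partA _ _ _ hj, mul_zero, mul_zero]
      intro h2
      exact h (by rw [show j = l by omega])
    · rw [L_orth' _ _ (by omega), zero_mul]
  · rw [IB, IBy i j j hi]
    exact mul_ne_zero (L_self _) (mul_ne_zero (by positivity) (partA' _ _ hj))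
  · rw [IC, ICx i k hi hk, zero_mul]
  · simp [dot2, vtTriII, Btri]
  · rw [IIC, Cx i k hi hk]
    by_cases hik : i = k
    · subst hik
      rw [ICy i j l hi, partD, mul_zero, mul_zero]
      intro h2
      exact h (by rw [show j = l by omega])
    · rw [L_orth' _ _ (by omega), mul_zero, zero_mul]
  · rw [IIC, Cx i i hi hi, ICy i j j hi]
    exact mul_ne_zero (mul_ne_zero (by norm_num) (L_self _))
      (mul_ne_zero (mul_ne_zero (by norm_num) (by positivity)) (partD' _ _))
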